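/- Recovery of the intervention parameters from the pair (Σ, Σ⋆): one has λ = (Σ a⋆ b − Σ⋆ a⋆ b) / Σ a⋆ a⋆ (the denominator is positive since Σ is positive definite), and for every c ∈ de(b) with c ≠ b, λ · Σ a⋆ a⋆ · (P b c) = Σ a⋆ c − Σ⋆ a⋆ c. In particular λ is uniquely determined by Σ and Σ⋆, and when λ ≠ 0 so is each P b c. -/

import Mathlib

open Matrix

attribute [local instance] Classical.propDecidable

namespace EdgeIntervention

variable {n : ℕ}

/-- Descendants of `b` (including `b`): vertices reachable under the edge relation of `D`. -/
def desc (D : Set (Fin n × Fin n)) (b : Fin n) : Set (Fin n) :=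
  {c | Relation.ReflTransGen (fun i j => (i, j) ∈ D) b c}

/-- Ancestors of `c` (including `c`). -/
def anc (D : Set (Fin n × Fin n)) (c : Fin n) : Set (Fin n) :=
  {i | c ∈ desc D i}

/-- Descendants of `b` in the induced subgraph on `W`. -/
def descW (D : Set (Fin n × Fin n)) (W : Set (Fin n)) (b : Fin n) : Set (Fin n) :=
  {c | Relation.ReflTransGen (fun i j => (i, j) ∈ D ∧ i ∈ W ∧ j ∈ W) b c}

/-- District of `b` in the induced subgraph on `W`. -/
def disW (B : Set (Fin n × Fin n)) (W : Set (Fin n)) (b : Fin n) : Set (Fin n) :=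
  {c | Relation.ReflTransGen (fun i j => (i, j) ∈ B ∧ i ∈ W ∧ j ∈ W) b c}

/-- Markov blanket of `b` in the induced subgraph on `W`. -/
def mbW (D B : Set (Fin n × Fin n)) (W : Set (Fin n)) (b : Fin n) : Set (Fin n) :=
  (disW B W b ∪ {i | i ∈ W ∧ ∃ d ∈ disW B W b, (i, d) ∈ D}) \ {b}

/-- `Λ` is supported on the directed edge set `D`. -/
def DSupported (D : Set (Fin n × Fin n)) (Λ : Matrix (Fin n) (Fin n) ℝ) : Prop :=
  ∀ i j, (i, j) ∉ D → Λ i j = 0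

/-- `Ω` is compatible with the bidirected edge set `B`: symmetric, positive definite,
and vanishing off the diagonal and off `B`. -/
def BCompatible (B : Set (Fin n × Fin n)) (Ω : Matrix (Fin n) (Fin n) ℝ) : Prop :=
  Ω.IsSymm ∧ Ω.PosDef ∧ ∀ i j, i ≠ j → (i, j) ∉ B → Ω i j = 0

/-- The covariance matrix `Σ = ((1 - Λ)⁻¹)ᵀ * Ω * (1 - Λ)⁻¹` of the linear SEM. -/
noncomputable def cov (Λ Ω : Matrix (Fin n) (Fin n) ℝ) : Matrix (Fin n) (Fin n) ℝ :=
  ((1 - Λ)⁻¹)ᵀ * Ω * (1 - Λ)⁻¹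

/-- Sum over all directed paths from `i` to `j` of their weights.  A path with `k` edges is
encoded as `f : Fin (k+1) → Fin n` with all steps in `D`; since edges strictly increase,
every directed path has at most `n` edges, so `k` ranges over `Finset.range (n+1)`. -/
noncomputable def pathSum (D : Set (Fin n × Fin n)) (Λ : Matrix (Fin n) (Fin n) ℝ)
    (i j : Fin n) : ℝ :=
  ∑ k ∈ Finset.range (n + 1),
    ∑ f ∈ Finset.univ.filter
        (fun f : Fin (k + 1) → Fin n =>
          f 0 = i ∧ f (Fin.last k) = j ∧ ∀ t : Fin k, (f t.castSucc, f t.succ) ∈ D),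
      ∏ t : Fin k, Λ (f t.castSucc) (f t.succ)

/-- Conditional covariance `σ_{vw·S} = Σ v w − Σ_{vS} (Σ_{SS})⁻¹ Σ_{Sw}`. -/
noncomputable def condCov (Cov : Matrix (Fin n) (Fin n) ℝ) (S : Set (Fin n))
    (v w : Fin n) : ℝ :=
  letI := (Set.toFinite S).fintype
  Cov v w - ∑ i : S, ∑ j : S,
    Cov v i.val * (Cov.submatrix (Subtype.val : S → Fin n) Subtype.val)⁻¹ i j * Cov j.val w

/-- Regression coefficient `β_{vw·S} = σ_{vw·S} / σ_{vv·S}`. -/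
noncomputable def regCoef (Cov : Matrix (Fin n) (Fin n) ℝ) (S : Set (Fin n))
    (v w : Fin n) : ℝ :=
  condCov Cov S v w / condCov Cov S v v

/-- The matrix obtained from `Λ` by setting the `(a,b)` entry to `0`
(removal of the directed edge `a → b`). -/
def removeEdge (Λ : Matrix (Fin n) (Fin n) ℝ) (a b : Fin n) : Matrix (Fin n) (Fin n) ℝ :=
  Matrix.of fun i j => if i = a ∧ j = b then 0 else Λ i j

/-- The matrix obtained from `Ω` by setting the `(a,b)` and `(b,a)` entries to `0`
(removal of the bidirected edge `a ↔ b`). -/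
def removeBi (Ω : Matrix (Fin n) (Fin n) ℝ) (a b : Fin n) : Matrix (Fin n) (Fin n) ℝ :=
  Matrix.of fun i j => if (i = a ∧ j = b) ∨ (i = b ∧ j = a) then 0 else Ω i j

/-- A strictly upper triangular `Λ` makes `1 - Λ` upper triangular. -/
theorem blockTriangular_one_sub {Λ : Matrix (Fin n) (Fin n) ℝ}
    (hΛ : ∀ i j, j ≤ i → Λ i j = 0) : (1 - Λ).BlockTriangular id :=
  blockTriangular_one.sub fun i j hij => hΛ i j (le_of_lt hij)

theorem det_one_sub {Λ : Matrix (Fin n) (Fin n) ℝ}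
    (hΛ : ∀ i j, j ≤ i → Λ i j = 0) : (1 - Λ).det = 1 := by
  rw [det_of_isUpperTriangular (blockTriangular_one_sub hΛ)]
  exact Finset.prod_eq_one fun i _ => by simp [hΛ i i le_rfl]

theorem isUnit_det_one_sub {Λ : Matrix (Fin n) (Fin n) ℝ}
    (hΛ : ∀ i j, j ≤ i → Λ i j = 0) : IsUnit (1 - Λ).det := by
  simp [det_one_sub hΛ]

theorem inv_one_sub_apply_of_lt {Λ : Matrix (Fin n) (Fin n) ℝ}
    (hΛ : ∀ i j, j ≤ i → Λ i j = 0) {i j : Fin n} (hij : j < i) : (1 - Λ)⁻¹ i j = 0 := by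
  let := invertibleOfIsUnitDet _ (isUnit_det_one_sub hΛ)
  exact blockTriangular_inv_of_blockTriangular (blockTriangular_one_sub hΛ) hij

theorem inv_one_sub_apply_self {Λ : Matrix (Fin n) (Fin n) ℝ}
    (hΛ : ∀ i j, j ≤ i → Λ i j = 0) (b : Fin n) : (1 - Λ)⁻¹ b b = 1 := by
  have h := congrFun₂ (nonsing_inv_mul _ (isUnit_det_one_sub hΛ)) b b
  rw [mul_apply, Finset.sum_eq_single b] at h
  · simpa [hΛ b b le_rfl] using h
  · intro j _ hj
    rcases lt_or_gt_of_ne hj with hlt | hgt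
    · rw [inv_one_sub_apply_of_lt hΛ hlt, zero_mul]
    · rw [blockTriangular_one_sub hΛ hgt, mul_zero]
  · simp

theorem removeEdge_eq_sub (Λ : Matrix (Fin n) (Fin n) ℝ) (a b : Fin n) :
    removeEdge Λ a b = Λ - single a b (Λ a b) := by
  ext i j
  by_cases h : i = a ∧ j = b
  · obtain ⟨rfl, rfl⟩ := h
    simp [removeEdge]
  · have h' : ¬ (a = i ∧ b = j) := fun hc => h ⟨hc.1.symm, hc.2.symm⟩
    simp [removeEdge, h, h']

/-- Removing an edge changes the path matrix by a rank-one term. -/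
theorem inv_one_sub_sub_inv_one_sub_removeEdge {Λ : Matrix (Fin n) (Fin n) ℝ}
    (hΛ : ∀ i j, j ≤ i → Λ i j = 0) (a b i c : Fin n) :
    (1 - Λ)⁻¹ i c - (1 - removeEdge Λ a b)⁻¹ i c
      = Λ a b * (1 - removeEdge Λ a b)⁻¹ i a * (1 - Λ)⁻¹ b c := by
  have hΛ' : ∀ i j, j ≤ i → removeEdge Λ a b i j = 0 := fun i j hij => by
    simp [removeEdge, hΛ i j hij]
  have key : (1 - Λ)⁻¹ - (1 - removeEdge Λ a b)⁻¹
      = (1 - removeEdge Λ a b)⁻¹ * single a b (Λ a b) * (1 - Λ)⁻¹ := by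
    have h : single a b (Λ a b) = (1 - removeEdge Λ a b) - (1 - Λ) := by
      rw [removeEdge_eq_sub]; abel
    rw [h, mul_sub, sub_mul, nonsing_inv_mul _ (isUnit_det_one_sub hΛ'), one_mul,
      mul_assoc, mul_nonsing_inv _ (isUnit_det_one_sub hΛ), mul_one]
  rw [← Matrix.sub_apply, key, mul_apply, Finset.sum_eq_single b]
  · rw [mul_single_apply_same]; ring
  · intro j _ hj
    rw [mul_single_apply_of_ne _ _ _ _ _ hj, zero_mul]
  · simp

/-- Removing the edge `a → b` changes the covariance of `a` and `c` by
`λ Σ a a (P b c)`. -/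
theorem cov_sub_cov_removeEdge {Λ : Matrix (Fin n) (Fin n) ℝ}
    (hΛ : ∀ i j, j ≤ i → Λ i j = 0) (Ω : Matrix (Fin n) (Fin n) ℝ) {a b : Fin n}
    (hab : a < b) (c : Fin n) :
    cov Λ Ω a c - cov (removeEdge Λ a b) Ω a c
      = Λ a b * cov Λ Ω a a * (1 - Λ)⁻¹ b c := by
  have hcol : ∀ i, (1 - removeEdge Λ a b)⁻¹ i a = (1 - Λ)⁻¹ i a := fun i => by
    have h := inv_one_sub_sub_inv_one_sub_removeEdge hΛ a b i a
    rw [inv_one_sub_apply_of_lt hΛ hab, mul_zero] at h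
    exact (sub_eq_zero.mp h).symm
  have hrow : ∀ i, (((1 - removeEdge Λ a b)⁻¹)ᵀ * Ω : Matrix _ _ ℝ) a i
      = (((1 - Λ)⁻¹)ᵀ * Ω : Matrix _ _ ℝ) a i :=
    fun i => by simp only [mul_apply, transpose_apply, hcol]
  simp only [cov]
  rw [mul_apply, mul_apply (N := (1 - removeEdge Λ a b)⁻¹), mul_apply, ← Finset.sum_sub_distrib,
    Finset.mul_sum, Finset.sum_mul]
  refine Finset.sum_congr rfl fun i _ => ?_
  rw [hrow, ← mul_sub, inv_one_sub_sub_inv_one_sub_removeEdge hΛ, hcol]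
  ring

theorem cov_posDef {Λ Ω : Matrix (Fin n) (Fin n) ℝ}
    (hΛ : ∀ i j, j ≤ i → Λ i j = 0) (hΩ : Ω.PosDef) : (cov Λ Ω).PosDef := by
  have hu : IsUnit (1 - Λ)⁻¹ :=
    isUnit_nonsing_inv_iff.mpr ((isUnit_iff_isUnit_det _).mpr (isUnit_det_one_sub hΛ))
  have h := hΩ.conjTranspose_mul_mul_same (mulVec_injective_of_isUnit hu)
  rwa [conjTranspose_eq_transpose_of_trivial] at h

/-- recovery of the intervention parameters from `(Σ, Σ⋆)`:
`λ = (Σ a⋆ b − Σ⋆ a⋆ b) / Σ a⋆ a⋆` (the denominator being positive), and for every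
`c ∈ de(b)` with `c ≠ b`, `λ Σ a⋆ a⋆ (P b c) = Σ a⋆ c − Σ⋆ a⋆ c`; in particular, when
`λ ≠ 0`, each `P b c` is determined by `Σ` and `Σ⋆`. -/
theorem remove_edge_recover_params (n : ℕ) (D B : Set (Fin n × Fin n))
    (hD : ∀ i j : Fin n, (i, j) ∈ D → i < j)
    (hBsymm : ∀ i j : Fin n, (i, j) ∈ B → (j, i) ∈ B)
    (hBirr : ∀ i : Fin n, (i, i) ∉ B)
    (Λ Ω : Matrix (Fin n) (Fin n) ℝ)
    (hΛ : DSupported D Λ) (hΩ : BCompatible B Ω)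
    (astar b : Fin n) (hab : (astar, b) ∈ D) :
    0 < cov Λ Ω astar astar ∧
    Λ astar b
      = (cov Λ Ω astar b - cov (removeEdge Λ astar b) Ω astar b) / cov Λ Ω astar astar ∧
    (∀ c : Fin n, c ∈ desc D b → c ≠ b →
      Λ astar b * cov Λ Ω astar astar * (1 - Λ)⁻¹ b c
        = cov Λ Ω astar c - cov (removeEdge Λ astar b) Ω astar c) ∧
    (∀ c : Fin n, c ∈ desc D b → c ≠ b → Λ astar b ≠ 0 →
      (1 - Λ)⁻¹ b c
        = (cov Λ Ω astar c - cov (removeEdge Λ astar b) Ω astar c)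
            / (Λ astar b * cov Λ Ω astar astar)) := by
  have hΛ' : ∀ i j, j ≤ i → Λ i j = 0 := fun i j hij =>
    hΛ i j fun h => (hD i j h).not_ge hij
  have hpos : 0 < cov Λ Ω astar astar := (cov_posDef hΛ' hΩ.2.1).diag_pos
  have hcov := cov_sub_cov_removeEdge hΛ' Ω (hD _ _ hab)
  refine ⟨hpos, ?_, fun c _ _ => (hcov c).symm, fun c _ _ hne => ?_⟩
  · rw [hcov, inv_one_sub_apply_self hΛ', mul_one, mul_div_cancel_right₀ _ hpos.ne']
  · rw [hcov, mul_div_cancel_left₀ _ (mul_ne_zero hne hpos.ne')]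

end EdgeIntervention
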